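/- Let 0 < m < M and let A_j, B_j (1 ≤ j ≤ n) be positive invertible bounded operators on a complex Hilbert space with m A_j ≤ B_j ≤ M A_j for all j. Then ((√M + √m)/(2 (Mm)^{1/4})) · Σ_{j=1}^n (A_j ♯ B_j) ≥ (Σ_{j=1}^n A_j ∇ B_j) ♯ (Σ_{j=1}^n A_j ! B_j) ≥ ((1 + √(mM))/√((1+M)(1+m))) · (Σ_{j=1}^n A_j) ♯ (Σ_{j=1}^n B_j). -/

import Mathlib

variable {H : Type*} [NormedAddCommGroup H] [InnerProductSpace ℂ H] [CompleteSpace H]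

/-- Real power `A^r` of a bounded operator, via the continuous functional calculus. -/
noncomputable def opRpow (A : H →L[ℂ] H) (r : ℝ) : H →L[ℂ] H :=
  cfc (fun x : ℝ => x ^ r) A

/-- The weighted operator geometric mean
`A ♯_μ B = A^{1/2} (A^{-1/2} B A^{-1/2})^μ A^{1/2}`. -/
noncomputable def wgm (μ : ℝ) (A B : H →L[ℂ] H) : H →L[ℂ] H :=
  opRpow A (1/2) * opRpow (opRpow A (-(1/2)) * B * opRpow A (-(1/2))) μ * opRpow A (1/2)

/-- The operator geometric mean `A ♯ B`. -/
noncomputable def geomMean (A B : H →L[ℂ] H) : H →L[ℂ] H := wgm (1/2) A B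

/-- The operator arithmetic mean `A ∇ B = (A + B)/2`. -/
noncomputable def arithMean (A B : H →L[ℂ] H) : H →L[ℂ] H := ((1 : ℝ)/2) • (A + B)

/-- The operator harmonic mean `A ! B = ((A⁻¹ + B⁻¹)/2)⁻¹`. -/
noncomputable def harmMean (A B : H →L[ℂ] H) : H →L[ℂ] H :=
  Ring.inverse (((1 : ℝ)/2) • (Ring.inverse A + Ring.inverse B))


theorem rm_inv (a b : H →L[ℂ] H) (h : a * b = 1) (h' : b * a = 1) : Ring.inverse a = b :=
  Ring.inverse_unit ⟨a, b, h, h'⟩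

theorem rm_lin (D : H →L[ℂ] H) (hD : IsSelfAdjoint D) (α β : ℝ) :
    cfc (fun x : ℝ => α * 1 + β * x) D = α • (1 : H →L[ℂ] H) + β • D := by
  rw [cfc_add .., cfc_const_mul .., cfc_const_mul .., cfc_const_one ℝ D, cfc_id' ℝ D]

theorem rm_half (D : H →L[ℂ] H) (hD : IsSelfAdjoint D) :
    cfc (fun x : ℝ => (1/2) * (1 + x)) D = ((1:ℝ)/2) • ((1 : H →L[ℂ] H) + D) := by
  rw [cfc_const_mul .., cfc_add .., cfc_const_one ℝ D, cfc_id' ℝ D]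

theorem rm_comb (D : H →L[ℂ] H) (f g : ℝ → ℝ) (hf : ContinuousOn f (spectrum ℝ D))
    (hg : ContinuousOn g (spectrum ℝ D)) (t s : ℝ) :
    cfc (fun x : ℝ => t * f x + s * g x) D = t • cfc f D + s • cfc g D := by
  rw [cfc_add _ _ _ (hf.const_mul t) (hg.const_mul s), cfc_const_mul _ _ _ hf,
    cfc_const_mul _ _ _ hg]

theorem rm_mul_one (D : H →L[ℂ] H) (hD : IsSelfAdjoint D) (f g : ℝ → ℝ)
    (hf : ContinuousOn f (spectrum ℝ D)) (hg : ContinuousOn g (spectrum ℝ D))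
    (h : ∀ x ∈ spectrum ℝ D, f x * g x = 1) : cfc f D * cfc g D = 1 := by
  rw [← cfc_mul f g D hf hg, ← cfc_const_one ℝ D hD]
  exact cfc_congr h

/-- Factorisation data for the pair `(A, B)`. -/
theorem rm_data (A B : H →L[ℂ] H) (hA : 0 ≤ A) (hAu : IsUnit A) (hB : 0 ≤ B) :
    ∃ C E D : H →L[ℂ] H, IsSelfAdjoint C ∧ IsSelfAdjoint E ∧ C * E = 1 ∧ E * C = 1 ∧
      C * C = A ∧ 0 ≤ D ∧ C * D * C = B ∧ D = E * B * E ∧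
      geomMean A B = C * cfc Real.sqrt D * C := by
  have hsp : IsStrictlyPositive A := ⟨hA, hAu⟩
  have hpos : ∀ x ∈ spectrum ℝ A, 0 < x := fun x hx => hsp.spectrum_pos hx
  have hcont : ∀ r : ℝ, ContinuousOn (fun x : ℝ => x ^ r) (spectrum ℝ A) := fun r x hx =>
    (Real.continuousAt_rpow_const x r (Or.inl (hpos x hx).ne')).continuousWithinAt
  have hmul : ∀ r s : ℝ, opRpow A r * opRpow A s = opRpow A (r + s) := by
    intro r s
    unfold opRpow
    rw [← cfc_mul _ _ A (hcont r) (hcont s)]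
    exact cfc_congr fun x hx => (Real.rpow_add (hpos x hx) r s).symm
  have h0 : opRpow A 0 = 1 := by
    unfold opRpow
    simp only [Real.rpow_zero]
    exact cfc_const_one ℝ A
  have h1 : opRpow A 1 = A := by
    unfold opRpow
    simp only [Real.rpow_one]
    exact cfc_id' ℝ A
  have hCE : opRpow A (1/2) * opRpow A (-(1/2)) = 1 := by
    rw [hmul, add_neg_cancel, h0]
  have hEC : opRpow A (-(1/2)) * opRpow A (1/2) = 1 := by
    rw [hmul, neg_add_cancel, h0]
  have hEs : IsSelfAdjoint (opRpow A (-(1/2))) := cfc_predicate _ _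
  refine ⟨opRpow A (1/2), opRpow A (-(1/2)), opRpow A (-(1/2)) * B * opRpow A (-(1/2)),
    cfc_predicate _ _, hEs, hCE, hEC, ?_, ?_, ?_, rfl, ?_⟩
  · rw [hmul, add_halves, h1]
  · have := hEs.conjugate_le_conjugate hB
    simpa using this
  · calc _ = (opRpow A (1/2) * opRpow A (-(1/2))) * B *
        (opRpow A (-(1/2)) * opRpow A (1/2)) := by simp only [mul_assoc]
      _ = B := by rw [hCE, hEC, one_mul, mul_one]
  · unfold geomMean wgm
    congr 2
    unfold opRpow
    congr 1
    funext x
    rw [Real.sqrt_eq_rpow]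

theorem rm_amgm (X Y : H →L[ℂ] H) (hX : 0 ≤ X) (hXu : IsUnit X) (hY : 0 ≤ Y)
    (t : ℝ) (ht : 0 < t) : geomMean X Y ≤ (t / 2) • X + (t⁻¹ / 2) • Y := by
  obtain ⟨C, E, D, hC, hE, hCE, hEC, hCC, hD, hCD, -, hG⟩ := rm_data X Y hX hXu hY
  have key : cfc Real.sqrt D ≤ (t / 2) • (1 : H →L[ℂ] H) + (t⁻¹ / 2) • D := by
    have e : cfc (fun x : ℝ => (t/2) * 1 + (t⁻¹/2) * x) D
        = (t / 2) • (1 : H →L[ℂ] H) + (t⁻¹ / 2) • D := by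
      rw [cfc_add .., cfc_const_mul .., cfc_const_mul .., cfc_const_one ℝ D, cfc_id' ℝ D]
    rw [← e]
    refine cfc_mono fun x hx => ?_
    have hx0 : 0 ≤ x := spectrum_nonneg_of_nonneg hD hx
    have h2 := Real.sq_sqrt hx0
    have : (t/2) * 1 + (t⁻¹/2) * x - Real.sqrt x = (t - Real.sqrt x)^2 / (2*t) := by
      field_simp
      rw [sub_sq, h2]; ring
    have : 0 ≤ (t - Real.sqrt x)^2 / (2*t) := by positivity
    linarith
  have := hC.conjugate_le_conjugate key
  rw [hG]
  refine this.trans_eq ?_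
  simp only [mul_add, add_mul, smul_mul_assoc, mul_smul_comm, mul_one, hCC, hCD]

/-- If `G X⁻¹ G ≤ Y` then `G ≤ X ♯ Y`. -/
theorem rm_riccati (X Y G W : H →L[ℂ] H) (hX : 0 ≤ X) (hXu : IsUnit X) (hY : 0 ≤ Y)
    (hG : 0 ≤ G) (hW : W * X = 1) (hle : G * W * G ≤ Y) : G ≤ geomMean X Y := by
  obtain ⟨C, E, D, hC, hE, hCE, hEC, hCC, hD, hCD, hDE, hGm⟩ := rm_data X Y hX hXu hY
  have hWE : W = E * E := by
    calc W = W * X * (E * E) := by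
          rw [← hCC, mul_assoc, mul_assoc C C, ← mul_assoc C E E, hCE, one_mul, hCE, mul_one]
      _ = E * E := by rw [hW, one_mul]
  have hnn : 0 ≤ E * G * E := by simpa using hE.conjugate_le_conjugate hG
  have h1 : (E * G * E) * (E * G * E) ≤ D := by
    have := hE.conjugate_le_conjugate hle
    rw [hDE]
    refine le_trans (le_of_eq ?_) this
    rw [hWE]; simp only [mul_assoc]
  have h2 := CFC.sqrt_le_sqrt _ _ h1
  rw [CFC.sqrt_mul_self _ hnn, CFC.sqrt_eq_real_sqrt D hD,
    cfcₙ_eq_cfc (hf := Real.continuous_sqrt.continuousOn) (hf0 := Real.sqrt_zero)] at h2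
  have h3 := hC.conjugate_le_conjugate h2
  rw [hGm]
  refine le_trans (le_of_eq ?_) h3
  calc G = (C * E) * G * (E * C) := by rw [hCE, hEC, one_mul, mul_one]
    _ = _ := by simp only [mul_assoc]

theorem rm_harm (A B C E D : H →L[ℂ] H) (hCE : C * E = 1) (hEC : E * C = 1)
    (hCC : C * C = A) (hD : 0 ≤ D) (hDpos : ∀ x ∈ spectrum ℝ D, 0 < x) (hCD : C * D * C = B) :
    harmMean A B = C * cfc (fun x : ℝ => 2 * x / (1 + x)) D * C := by
  have hne : ∀ x ∈ spectrum ℝ D, (1 + x) ≠ 0 := fun x hx => by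
    have := hDpos x hx
    positivity
  have hne0 : ∀ x ∈ spectrum ℝ D, x ≠ 0 := fun x hx => (hDpos x hx).ne'
  have cinv : ContinuousOn (fun x : ℝ => x⁻¹) (spectrum ℝ D) := continuousOn_id.inv₀ hne0
  have ch : ContinuousOn (fun x : ℝ => 2 * x / (1 + x)) (spectrum ℝ D) :=
    ContinuousOn.div (by fun_prop) (by fun_prop) hne
  have ck : ContinuousOn (fun x : ℝ => (1/2) * (1 + x⁻¹)) (spectrum ℝ D) := by fun_prop
  set I := cfc (fun x : ℝ => x⁻¹) D with hI
  have hDs : IsSelfAdjoint D := IsSelfAdjoint.of_nonneg hD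
  have hDI : D * I = 1 := by
    have := rm_mul_one D hDs (fun x => x) (fun x => x⁻¹) continuousOn_id cinv
      fun x hx => mul_inv_cancel₀ (hne0 x hx)
    rwa [cfc_id' ℝ D hDs] at this
  have hID : I * D = 1 := by
    have := rm_mul_one D hDs (fun x => x⁻¹) (fun x => x) cinv continuousOn_id
      fun x hx => inv_mul_cancel₀ (hne0 x hx)
    rwa [cfc_id' ℝ D hDs] at this
  have hK : cfc (fun x : ℝ => (1/2) * (1 + x⁻¹)) D = ((1:ℝ)/2) • (1 + I) := by
    rw [cfc_const_mul _ (fun x : ℝ => 1 + x⁻¹) _ (continuousOn_const.add cinv),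
      cfc_add _ _ _ continuousOn_const cinv, cfc_const_one ℝ D hDs]
  have c1 : ∀ Z : H →L[ℂ] H, C * (E * Z) = Z := fun Z => by rw [← mul_assoc, hCE, one_mul]
  have c2 : ∀ Z : H →L[ℂ] H, E * (C * Z) = Z := fun Z => by rw [← mul_assoc, hEC, one_mul]
  have c3 : ∀ Z : H →L[ℂ] H, D * (I * Z) = Z := fun Z => by rw [← mul_assoc, hDI, one_mul]
  have c4 : ∀ Z : H →L[ℂ] H, I * (D * Z) = Z := fun Z => by rw [← mul_assoc, hID, one_mul]
  have iA : Ring.inverse A = E * E := by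
    refine rm_inv _ _ ?_ ?_ <;>
    simp only [← hCC, mul_assoc, c1, c2, hCE, hEC]
  have iB : Ring.inverse B = E * I * E := by
    refine rm_inv _ _ ?_ ?_ <;>
    simp only [← hCD, mul_assoc, c1, c2, c3, c4, hCE, hEC]
  have hsum : ((1:ℝ)/2) • (Ring.inverse A + Ring.inverse B)
      = E * cfc (fun x : ℝ => (1/2) * (1 + x⁻¹)) D * E := by
    rw [iA, iB, hK]
    simp only [mul_add, add_mul, smul_mul_assoc, mul_smul_comm, mul_one]
  have hc : ∀ x ∈ spectrum ℝ D, (1/2) * (1 + x⁻¹) * (2 * x / (1 + x)) = 1 := fun x hx => by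
    have := hne x hx
    have := hne0 x hx
    field_simp
    ring
  have d1 : cfc (fun x : ℝ => (1/2) * (1 + x⁻¹)) D * cfc (fun x : ℝ => 2 * x / (1 + x)) D = 1 := 
    rm_mul_one D hDs _ _ ck ch hc
  have d2 : cfc (fun x : ℝ => 2 * x / (1 + x)) D * cfc (fun x : ℝ => (1/2) * (1 + x⁻¹)) D = 1 := 
    rm_mul_one D hDs _ _ ch ck fun x hx => by rw [mul_comm]; exact hc x hx
  unfold harmMean
  rw [hsum]
  generalize cfc (fun x : ℝ => (1/2) * (1 + x⁻¹)) D = P at *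
  generalize cfc (fun x : ℝ => 2 * x / (1 + x)) D = Q at *
  have c5 : ∀ Z : H →L[ℂ] H, P * (Q * Z) = Z := fun Z => by rw [← mul_assoc, d1, one_mul]
  have c6 : ∀ Z : H →L[ℂ] H, Q * (P * Z) = Z := fun Z => by rw [← mul_assoc, d2, one_mul]
  refine rm_inv _ _ ?_ ?_ <;>
    simp only [mul_assoc, c1, c2, c5, c6, hCE, hEC]

theorem rm_spec_lower (A B C E D : H →L[ℂ] H) (hE : IsSelfAdjoint E) (hCE : C * E = 1)
    (hEC : E * C = 1) (hCC : C * C = A) (hD : 0 ≤ D) (hDE : D = E * B * E)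
    (m : ℝ) (h : m • A ≤ B) : ∀ x ∈ spectrum ℝ D, m ≤ x := by
  have := hE.conjugate_le_conjugate h
  rw [← hDE, ← hCC, mul_smul_comm, smul_mul_assoc, mul_assoc, mul_assoc, hCE, mul_one, hEC,
    ← Algebra.algebraMap_eq_smul_one] at this
  exact (algebraMap_le_iff_le_spectrum (IsSelfAdjoint.of_nonneg hD)).1 this

theorem rm_spec_upper (A B C E D : H →L[ℂ] H) (hE : IsSelfAdjoint E) (hCE : C * E = 1)
    (hEC : E * C = 1) (hCC : C * C = A) (hD : 0 ≤ D) (hDE : D = E * B * E)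
    (m : ℝ) (h : B ≤ m • A) : ∀ x ∈ spectrum ℝ D, x ≤ m := by
  have := hE.conjugate_le_conjugate h
  rw [← hDE, ← hCC, mul_smul_comm, smul_mul_assoc, mul_assoc, mul_assoc, hCE, mul_one, hEC,
    ← Algebra.algebraMap_eq_smul_one] at this
  exact (le_algebraMap_iff_spectrum_le (IsSelfAdjoint.of_nonneg hD)).1 this

theorem rm_pair (A B : H →L[ℂ] H) (hA : 0 ≤ A) (hAu : IsUnit A) (hB : 0 ≤ B)
    (m M : ℝ) (hm : 0 < m) (h1 : m • A ≤ B) (h2 : B ≤ M • A) (t s c α β : ℝ)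
    (hs : ∀ x, m ≤ x → x ≤ M →
      t * ((1/2) * (1 + x)) + s * (2 * x / (1 + x)) ≤ c * Real.sqrt x)
    (hs' : ∀ x, m ≤ x → x ≤ M → α * 1 + β * x ≤ 2 * x / (1 + x)) :
    t • arithMean A B + s • harmMean A B ≤ c • geomMean A B ∧
    α • A + β • B ≤ harmMean A B := by
  obtain ⟨C, E, D, hC, hE, hCE, hEC, hCC, hD, hCD, hDE, hG⟩ := rm_data A B hA hAu hB
  have hl := rm_spec_lower A B C E D hE hCE hEC hCC hD hDE m h1
  have hu := rm_spec_upper A B C E D hE hCE hEC hCC hD hDE M h2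
  have hpos : ∀ x ∈ spectrum ℝ D, 0 < x := fun x hx => hm.trans_le (hl x hx)
  have hDs : IsSelfAdjoint D := IsSelfAdjoint.of_nonneg hD
  have hH := rm_harm A B C E D hCE hEC hCC hD hpos hCD
  have ch : ContinuousOn (fun x : ℝ => 2 * x / (1 + x)) (spectrum ℝ D) :=
    ContinuousOn.div (by fun_prop) (by fun_prop) fun x hx => by
      have := hpos x hx
      positivity
  constructor
  · have e : cfc (fun x : ℝ => t * ((1/2) * (1 + x)) + s * (2 * x / (1 + x))) D
        = t • (((1:ℝ)/2) • (1 + D)) + s • cfc (fun x : ℝ => 2 * x / (1 + x)) D := by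
      rw [rm_comb D _ _ (by fun_prop) ch, rm_half D hDs]
    have key : cfc (fun x : ℝ => t * ((1/2) * (1 + x)) + s * (2 * x / (1 + x))) D
        ≤ cfc (fun x : ℝ => c * Real.sqrt x) D :=
      cfc_mono (fun x hx => hs x (hl x hx) (hu x hx))
        (ContinuousOn.add (by fun_prop) (ch.const_mul s))
        (Real.continuous_sqrt.continuousOn.const_mul c)
    rw [e, cfc_const_mul _ _ _ Real.continuous_sqrt.continuousOn] at key
    have := hC.conjugate_le_conjugate key
    rw [hG, hH, arithMean, ← hCD]
    conv_lhs => rw [← hCC]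
    simpa only [mul_add, add_mul, smul_mul_assoc, mul_smul_comm, mul_one] using this
  · have e : cfc (fun x : ℝ => α * 1 + β * x) D = α • (1 : H →L[ℂ] H) + β • D :=
      rm_lin D hDs α β
    have key : cfc (fun x : ℝ => α * 1 + β * x) D ≤ cfc (fun x : ℝ => 2 * x / (1 + x)) D :=
      cfc_mono (fun x hx => hs' x (hl x hx) (hu x hx)) (by fun_prop) ch
    rw [e] at key
    have := hC.conjugate_le_conjugate key
    rw [hH, ← hCD]
    conv_lhs => rw [← hCC]
    simpa only [mul_add, add_mul, smul_mul_assoc, mul_smul_comm, mul_one] using this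

theorem rm_second (A B Y : H →L[ℂ] H) (hA : 0 ≤ A) (hAu : IsUnit A) (hB : 0 ≤ B) (hY : 0 ≤ Y)
    (m : ℝ) (hm : 0 < m) (h1 : m • A ≤ B) (k α β : ℝ) (hk : 0 ≤ k)
    (hs : ∀ x, 0 < x → k * k * (2 * x / (1 + x)) ≤ α * 1 + β * x)
    (hle : α • A + β • B ≤ Y) :
    k • geomMean A B ≤ geomMean (((1:ℝ)/2) • (A + B)) Y := by
  obtain ⟨C, E, D, hC, hE, hCE, hEC, hCC, hD, hCD, hDE, hG⟩ := rm_data A B hA hAu hB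
  have hl := rm_spec_lower A B C E D hE hCE hEC hCC hD hDE m h1
  have hpos : ∀ x ∈ spectrum ℝ D, 0 < x := fun x hx => hm.trans_le (hl x hx)
  have hDs : IsSelfAdjoint D := IsSelfAdjoint.of_nonneg hD
  have hne : ∀ x ∈ spectrum ℝ D, (1 + x) ≠ 0 := fun x hx => by
    have := hpos x hx
    positivity
  have ch : ContinuousOn (fun x : ℝ => 2 / (1 + x)) (spectrum ℝ D) :=
    ContinuousOn.div (by fun_prop) (by fun_prop) hne
  have ch' : ContinuousOn (fun x : ℝ => 2 * x / (1 + x)) (spectrum ℝ D) :=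
    ContinuousOn.div (by fun_prop) (by fun_prop) hne
  have c1 : ∀ Z : H →L[ℂ] H, C * (E * Z) = Z := fun Z => by rw [← mul_assoc, hCE, one_mul]
  have c2 : ∀ Z : H →L[ℂ] H, E * (C * Z) = Z := fun Z => by rw [← mul_assoc, hEC, one_mul]
  have hX0 : 0 ≤ ((1:ℝ)/2) • (A + B) := smul_nonneg (by norm_num) (add_nonneg hA hB)
  have eX : ((1:ℝ)/2) • (A + B) = C * cfc (fun x : ℝ => (1/2) * (1 + x)) D * C := by
    rw [rm_half D hDs, ← hCD]
    conv_lhs => rw [← hCC]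
    simp only [mul_add, add_mul, smul_mul_assoc, mul_smul_comm, mul_one]
  have d1 : cfc (fun x : ℝ => 2 / (1 + x)) D * cfc (fun x : ℝ => (1/2) * (1 + x)) D = 1 := by
    refine rm_mul_one D hDs _ _ ch (by fun_prop) fun x hx => ?_
    have := hne x hx
    field_simp
  have d2 : cfc (fun x : ℝ => (1/2) * (1 + x)) D * cfc (fun x : ℝ => 2 / (1 + x)) D = 1 := by
    refine rm_mul_one D hDs _ _ (by fun_prop) ch fun x hx => ?_
    have := hne x hx
    field_simp
  have hW : (E * cfc (fun x : ℝ => 2 / (1 + x)) D * E) * (((1:ℝ)/2) • (A + B)) = 1 := by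
    rw [eX]
    simp only [mul_assoc, c2]
    rw [← mul_assoc (cfc _ D) (cfc _ D), d1, one_mul, hEC]
  have hW' : (((1:ℝ)/2) • (A + B)) * (E * cfc (fun x : ℝ => 2 / (1 + x)) D * E) = 1 := by
    rw [eX]
    simp only [mul_assoc, c1]
    rw [← mul_assoc (cfc _ D) (cfc _ D), d2, one_mul, hCE]
  have hXu : IsUnit (((1:ℝ)/2) • (A + B)) := ⟨⟨_, _, hW', hW⟩, rfl⟩
  have hsq : 0 ≤ cfc Real.sqrt D := cfc_nonneg fun x _ => Real.sqrt_nonneg x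
  have hG0 : 0 ≤ geomMean A B := by
    rw [hG]
    simpa using hC.conjugate_le_conjugate hsq
  refine rm_riccati _ Y _ _ hX0 hXu hY (smul_nonneg hk hG0) hW ?_
  refine le_trans ?_ hle
  have e3 : cfc Real.sqrt D * cfc (fun x : ℝ => 2 / (1 + x)) D * cfc Real.sqrt D
      = cfc (fun x : ℝ => 2 * x / (1 + x)) D := by
    have cs : ContinuousOn Real.sqrt (spectrum ℝ D) := Real.continuous_sqrt.continuousOn
    rw [← cfc_mul _ _ D cs ch,
      ← cfc_mul (fun x : ℝ => √x * (2 / (1 + x))) Real.sqrt D (cs.mul ch) cs]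
    refine cfc_congr fun x hx => ?_
    have := Real.mul_self_sqrt (hpos x hx).le
    calc √x * (2 / (1 + x)) * √x = (√x * √x) * (2 / (1 + x)) := by ring
      _ = 2 * x / (1 + x) := by rw [this]; ring
  have key : cfc (fun x : ℝ => k * k * (2 * x / (1 + x))) D ≤ cfc (fun x : ℝ => α * 1 + β * x) D :=
    cfc_mono (fun x hx => hs x (hpos x hx)) (ch'.const_mul (k * k)) (by fun_prop)
  rw [cfc_const_mul _ _ _ ch', rm_lin D hDs, ← e3] at key
  have h3 := hC.conjugate_le_conjugate key
  rw [hG, ← hCD]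
  conv_rhs => rw [← hCC]
  simp only [mul_add, add_mul, smul_mul_assoc, mul_smul_comm, mul_one, mul_assoc, c1, c2,
    smul_smul] at h3 ⊢
  exact h3

theorem rm_scalar_aux (a b y : ℝ) (ha : 0 < a) (hb : 0 < b) (hy : 0 < y)
    (h1 : a ^ 2 ≤ y) (h2 : y ≤ b ^ 2) :
    (2 * a * b / (1 + a ^ 2 * b ^ 2)) / 2 * ((1/2) * (1 + y ^ 2)) +
      (2 * a * b / (1 + a ^ 2 * b ^ 2))⁻¹ / 2 * (2 * y ^ 2 / (1 + y ^ 2))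
      ≤ (b ^ 2 + a ^ 2) / (2 * (a * b)) * y := by
  have p1 : 0 ≤ y * (1 + a ^ 2 * b ^ 2) - a ^ 2 * (1 + y ^ 2) := by
    nlinarith [mul_nonneg (mul_nonneg (sq_nonneg a) hy.le) (sub_nonneg.2 h2)]
  have p2 : 0 ≤ b ^ 2 * (1 + y ^ 2) - y * (1 + a ^ 2 * b ^ 2) := by
    nlinarith [mul_nonneg (mul_nonneg (sq_nonneg b) hy.le) (sub_nonneg.2 h1)]
  have p3 := mul_nonneg p1 p2
  have : (b ^ 2 + a ^ 2) / (2 * (a * b)) * y -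
     ((2 * a * b / (1 + a ^ 2 * b ^ 2)) / 2 * ((1/2) * (1 + y ^ 2)) +
      (2 * a * b / (1 + a ^ 2 * b ^ 2))⁻¹ / 2 * (2 * y ^ 2 / (1 + y ^ 2)))
     = ((y * (1 + a ^ 2 * b ^ 2) - a ^ 2 * (1 + y ^ 2)) *
        (b ^ 2 * (1 + y ^ 2) - y * (1 + a ^ 2 * b ^ 2))) /
        (2 * a * b * (1 + a ^ 2 * b ^ 2) * (1 + y ^ 2)) := by
    field_simp
    ring
  have h4 : 0 ≤ ((y * (1 + a ^ 2 * b ^ 2) - a ^ 2 * (1 + y ^ 2)) *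
        (b ^ 2 * (1 + y ^ 2) - y * (1 + a ^ 2 * b ^ 2))) /
        (2 * a * b * (1 + a ^ 2 * b ^ 2) * (1 + y ^ 2)) := by positivity
  linarith

theorem rm_scalar (m M : ℝ) (hm : 0 < m) (hmM : m < M) :
    ∃ t : ℝ, 0 < t ∧ ∀ x, m ≤ x → x ≤ M →
      t / 2 * ((1/2) * (1 + x)) + t⁻¹ / 2 * (2 * x / (1 + x)) ≤
       ((Real.sqrt M + Real.sqrt m) / (2 * (M * m) ^ ((1 : ℝ)/4))) * Real.sqrt x := by
  have hM := hm.trans hmM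
  set a := √(√m) with ha
  set b := √(√M) with hb
  have ha0 : 0 < a := by positivity
  have hb0 : 0 < b := by positivity
  have ha2 : a ^ 2 = √m := Real.sq_sqrt (by positivity)
  have hb2 : b ^ 2 = √M := Real.sq_sqrt (by positivity)
  have hab : (M * m) ^ ((1 : ℝ)/4) = a * b := by
    have : M * m = (a * b) ^ (4 : ℝ) := by
      have h1 := Real.sq_sqrt hm.le
      have h2 := Real.sq_sqrt hM.le
      rw [← ha2] at h1
      rw [← hb2] at h2
      norm_cast
      rw [← h1, ← h2]
      ring
    rw [this, ← Real.rpow_mul (by positivity)]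
    norm_num
  refine ⟨2 * a * b / (1 + a ^ 2 * b ^ 2), by positivity, fun x hx1 hx2 => ?_⟩
  have hx : 0 < x := hm.trans_le hx1
  have := rm_scalar_aux a b (√x) ha0 hb0 (by positivity) (ha2 ▸ Real.sqrt_le_sqrt hx1)
    (hb2 ▸ Real.sqrt_le_sqrt hx2)
  rw [Real.sq_sqrt hx.le] at this
  rw [hab, ← ha2, ← hb2]
  exact this

/-- Operator reverse Milne inequality:
`((√M + √m)/(2(Mm)^{1/4})) · Σ (A_j ♯ B_j) ≥ (Σ A_j ∇ B_j) ♯ (Σ A_j ! B_j)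
  ≥ ((1+√(mM))/√((1+M)(1+m))) · (Σ A_j) ♯ (Σ B_j)`
whenever `0 < mA_j ≤ B_j ≤ MA_j`. -/
theorem reverse_milne_inequality
    (m M : ℝ) (hm : 0 < m) (hmM : m < M)
    (n : ℕ) (A B : Fin n → (H →L[ℂ] H))
    (hA : ∀ j, 0 ≤ A j) (hAu : ∀ j, IsUnit (A j))
    (hB : ∀ j, 0 ≤ B j) (hBu : ∀ j, IsUnit (B j))
    (h1 : ∀ j, m • A j ≤ B j) (h2 : ∀ j, B j ≤ M • A j) :
    geomMean (∑ j, arithMean (A j) (B j)) (∑ j, harmMean (A j) (B j)) ≤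
      ((Real.sqrt M + Real.sqrt m) / (2 * (M * m) ^ ((1 : ℝ)/4))) •
        ∑ j, geomMean (A j) (B j) ∧
    ((1 + Real.sqrt (m * M)) / Real.sqrt ((1 + M) * (1 + m))) •
        geomMean (∑ j, A j) (∑ j, B j) ≤
      geomMean (∑ j, arithMean (A j) (B j)) (∑ j, harmMean (A j) (B j)) := by
  have hM := hm.trans hmM
  obtain ⟨t, ht, hsc⟩ := rm_scalar m M hm hmM
  have hk2 : ∀ k, k = (1 + Real.sqrt (m * M)) / Real.sqrt ((1 + M) * (1 + m)) →
      k * k = (1 + Real.sqrt (m * M)) ^ 2 / ((1 + M) * (1 + m)) := by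
    rintro k rfl
    rw [div_mul_div_comm, Real.mul_self_sqrt (by positivity), sq]
  have hpair := fun j => rm_pair (A j) (B j) (hA j) (hAu j) (hB j) m M hm (h1 j) (h2 j)
    (t / 2) (t⁻¹ / 2) ((Real.sqrt M + Real.sqrt m) / (2 * (M * m) ^ ((1 : ℝ)/4)))
    (2 * (m * M) / ((1 + M) * (1 + m))) (2 / ((1 + M) * (1 + m))) hsc (by
      intro x hx1 hx2
      have hx : 0 < x := hm.trans_le hx1
      have e : 2 * x / (1 + x) - (2 * (m * M) / ((1 + M) * (1 + m)) * 1 +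
          2 / ((1 + M) * (1 + m)) * x)
          = 2 * ((x - m) * (M - x)) / ((1 + x) * ((1 + M) * (1 + m))) := by
        field_simp
        ring
      have : 0 ≤ 2 * ((x - m) * (M - x)) / ((1 + x) * ((1 + M) * (1 + m))) :=
        div_nonneg (mul_nonneg (by norm_num)
          (mul_nonneg (sub_nonneg.2 hx1) (sub_nonneg.2 hx2))) (by positivity)
      linarith)
  have hX : ∑ j, arithMean (A j) (B j) = ((1:ℝ)/2) • (∑ j, A j + ∑ j, B j) := by
    simp only [arithMean]
    rw [← Finset.smul_sum, Finset.sum_add_distrib]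
  have hYj : ∀ j, 0 ≤ harmMean (A j) (B j) := fun j => by
    refine le_trans ?_ (hpair j).2
    exact add_nonneg (smul_nonneg (by positivity) (hA j)) (smul_nonneg (by positivity) (hB j))
  have hY : 0 ≤ ∑ j, harmMean (A j) (B j) := Finset.sum_nonneg fun j _ => hYj j
  have hA' : 0 ≤ ∑ j, A j := Finset.sum_nonneg fun j _ => hA j
  have hB' : 0 ≤ ∑ j, B j := Finset.sum_nonneg fun j _ => hB j
  rcases Nat.eq_zero_or_pos n with rfl | hn
  · have h0 : geomMean (0 : H →L[ℂ] H) 0 = 0 := by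
      have : opRpow (0 : H →L[ℂ] H) (1/2) = 0 := by
        unfold opRpow
        rw [cfc_apply_zero]
        norm_num
      unfold geomMean wgm
      rw [this, mul_zero]
    simp [h0]
  · have hAu' : IsUnit (∑ j, A j) :=
      CStarAlgebra.isUnit_of_le (A ⟨0, hn⟩)
        (Finset.single_le_sum (f := A) (fun j _ => hA j) (Finset.mem_univ _)) ⟨hA _, hAu _⟩
    have hXu : IsUnit (∑ j, arithMean (A j) (B j)) := by
      rw [hX]
      have : IsUnit (∑ j, A j + ∑ j, B j) :=
        CStarAlgebra.isUnit_of_le (∑ j, A j) (le_add_of_nonneg_right hB') ⟨hA', hAu'⟩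
      exact this.smul (Units.mk0 ((1:ℝ)/2) (by norm_num))
    have hX0 : 0 ≤ ∑ j, arithMean (A j) (B j) := by
      rw [hX]
      exact smul_nonneg (by norm_num) (add_nonneg hA' hB')
    constructor
    · refine (rm_amgm _ _ hX0 hXu hY t ht).trans ?_
      rw [Finset.smul_sum, Finset.smul_sum, Finset.smul_sum, ← Finset.sum_add_distrib]
      exact Finset.sum_le_sum fun j _ => (hpair j).1
    · rw [hX]
      refine rm_second _ _ _ hA' hAu' hB' hY m hm ?_ _
        (2 * (m * M) / ((1 + M) * (1 + m))) (2 / ((1 + M) * (1 + m))) (by positivity) ?_ ?_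
      · rw [Finset.smul_sum]
        exact Finset.sum_le_sum fun j _ => h1 j
      · intro x hx
        rw [hk2 _ rfl]
        have hg := Real.sq_sqrt (show 0 ≤ m * M by positivity)
        rw [← hg, Real.sqrt_sq (Real.sqrt_nonneg _)]
        generalize √(m * M) = g
        have e : 2 * g ^ 2 / ((1 + M) * (1 + m)) * 1 + 2 / ((1 + M) * (1 + m)) * x -
          (1 + g) ^ 2 / ((1 + M) * (1 + m)) * (2 * x / (1 + x)) =
          2 * (x - g) ^ 2 / ((1 + x) * ((1 + M) * (1 + m))) := by
          field_simp
          ring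
        have : 0 ≤ 2 * (x - g) ^ 2 / ((1 + x) * ((1 + M) * (1 + m))) := by positivity
        linarith
      · rw [Finset.smul_sum, Finset.smul_sum, ← Finset.sum_add_distrib]
        exact Finset.sum_le_sum fun j _ => (hpair j).2
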